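/- (Type D, twisted combination.) Let p ≥ 0 and let Λ = (A,B) and Ξ = (A',B') be β-pairs of defect 0 with all four rows of cardinality p, as in the context. Then, computing b(Λ⊞Ξ) with the 𝕏-reference sequence, the equality a(Λ) + a(Ξ) = b(Λ⊞Ξ) holds if and only if for every 1 ≤ i ≤ p and every 1 ≤ j ≤ p, either (b_i ≤ a_j and a_i' ≤ b_j') or (b_i ≥ a_j and a_i' ≥ b_j'). -/

import Mathlib

namespace CSpaper

/-- The rank of a β-set: the sum of its elements minus `choose (card) 2`. -/
def bRank (B : Finset ℕ) : ℤ :=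
  (∑ b ∈ B, (b : ℤ)) - (B.card.choose 2 : ℤ)

/-- The `k`-th shift of a β-set: `{0,…,k-1} ∪ {b+k : b ∈ B}`. -/
def bShift (k : ℕ) (B : Finset ℕ) : Finset ℕ :=
  Finset.range k ∪ B.image (· + k)

/-- Shift-equivalence of β-sets. -/
def sEquiv (A B : Finset ℕ) : Prop :=
  ∃ k, bShift k A = B ∨ A = bShift k B

/-- A β-pair: an ordered pair of β-sets. -/
abbrev BPair := Finset ℕ × Finset ℕ

/-- The defect of a β-pair. -/
def pDefect (Λ : BPair) : ℤ := (Λ.1.card : ℤ) - (Λ.2.card : ℤ)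

/-- The rank of a β-pair: `rk A + rk B + ⌊(d/2)²⌋`. -/
def pRank (Λ : BPair) : ℤ := bRank Λ.1 + bRank Λ.2 + pDefect Λ ^ 2 / 4

/-- The `k`-th shift of a β-pair. -/
def pShift (k : ℕ) (Λ : BPair) : BPair := (bShift k Λ.1, bShift k Λ.2)

/-- Shift-equivalence of β-pairs: one is a shift of the other. -/
def pEquiv (Λ Ξ : BPair) : Prop := ∃ k, pShift k Λ = Ξ ∨ Λ = pShift k Ξ

/-- `Λ` is a representative of a symbol in `𝕍_N^d`. -/
def inV (N d : ℤ) (Λ : BPair) : Prop := pRank Λ = N ∧ pDefect Λ = d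

/-- The `i`-th smallest element of a finite set of naturals (0-indexed). -/
def nthEl (A : Finset ℕ) (i : ℕ) : ℕ := (A.sort (· ≤ ·)).getD i 0

/-- The operation `A ⊙ B = {a_1+b_1, a_2+b_2-1, …, a_s+b_s-(s-1)}` (0-indexed:
`a_i + b_i - i`). -/
def odot (A B : Finset ℕ) : Finset ℕ :=
  (Finset.range A.card).image fun i => nthEl A i + nthEl B i - i

/-- Dominance order `B ⊴ A`: every tail sum of `B` is at most the corresponding
tail sum of `A`. -/
def domLE (B A : Finset ℕ) : Prop :=
  ∀ k, ∑ i ∈ Finset.Ico k B.card, nthEl B i ≤ ∑ i ∈ Finset.Ico k A.card, nthEl A i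

/-- No two consecutive integers. -/
def noConsec (S : Finset ℕ) : Prop := ∀ x ∈ S, x + 1 ∉ S

/-- `{0,2,…,2k-2} ∪ {x+2k : x ∈ S}`. -/
def evShift (k : ℕ) (S : Finset ℕ) : Finset ℕ :=
  (Finset.range k).image (fun i => 2 * i) ∪ S.image (· + 2 * k)

/-- `{1,3,…,2k-1} ∪ {y+2k : y ∈ S}`. -/
def odShift (k : ℕ) (S : Finset ℕ) : Finset ℕ :=
  (Finset.range k).image (fun i => 2 * i + 1) ∪ S.image (· + 2 * k)

/-- The `k`-th shift in the 𝕐-family. -/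
def yShift (k : ℕ) (P : BPair) : BPair := (evShift k P.1, odShift k P.2)

/-- The `k`-th shift in the 𝕏-family. -/
def xShift (k : ℕ) (P : BPair) : BPair := (evShift k P.1, evShift k P.2)

/-- Shift-equivalence in the 𝕐-family. -/
def yEquiv (P Q : BPair) : Prop := ∃ k, yShift k P = Q ∨ P = yShift k Q

/-- Shift-equivalence in the 𝕏-family (unordered pairs, so swaps are allowed). -/
def xEquiv (P Q : BPair) : Prop :=
  ∃ k, xShift k P = Q ∨ xShift k P = Q.swap ∨ P = xShift k Q ∨ P.swap = xShift k Q

/-- Membership in `Ỹ_N`. -/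
def inYtilde (N : ℤ) (P : BPair) : Prop :=
  (∀ y ∈ P.2, 0 < y) ∧ Odd (P.1.card + P.2.card) ∧ noConsec P.1 ∧ noConsec P.2 ∧
    2 * ((∑ x ∈ P.1, (x : ℤ)) + ∑ y ∈ P.2, (y : ℤ)) =
      N + ((P.1.card + P.2.card : ℕ) : ℤ) * (((P.1.card + P.2.card : ℕ) : ℤ) - 1)

/-- The defect in the 𝕐-family: `|X| - |Y|`. -/
def yDefect (P : BPair) : ℤ := (P.1.card : ℤ) - (P.2.card : ℤ)

/-- Membership in `X̃_N`. -/
def inXtilde (N : ℤ) (P : BPair) : Prop :=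
  noConsec P.1 ∧ noConsec P.2 ∧
    2 * ((∑ x ∈ P.1, (x : ℤ)) + ∑ y ∈ P.2, (y : ℤ)) =
      N + (((P.1.card + P.2.card : ℕ) : ℤ) - 1) ^ 2 - 1

/-- The defect in the 𝕏-family: `||A| - |B||`. -/
def xDefect (P : BPair) : ℤ := |(P.1.card : ℤ) - (P.2.card : ℤ)|

/-- The map `Θ(A,B) = ({0, a_1+2, …, a_s+s+1}, {b_1+1, …, b_s+s})`. -/
def theta (Λ : BPair) : BPair :=
  (insert 0 ((Finset.range Λ.1.card).image fun i => nthEl Λ.1 i + i + 2),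
   (Finset.range Λ.2.card).image fun i => nthEl Λ.2 i + i + 1)

/-- The map `Θ'(A,B) = ({0, a_1+2, …, a_s+s+1}, {b_1, …, b_s+s-1})`. -/
def theta' (Λ : BPair) : BPair :=
  (insert 0 ((Finset.range Λ.1.card).image fun i => nthEl Λ.1 i + i + 2),
   (Finset.range Λ.2.card).image fun i => nthEl Λ.2 i + i)

/-- The map `Θ̄(A,B) = ({a_1, …, a_s+s-1}, {b_1, …, b_s+s-1})`. -/
def thetaBar (Λ : BPair) : BPair :=
  ((Finset.range Λ.1.card).image fun i => nthEl Λ.1 i + i,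
   (Finset.range Λ.2.card).image fun i => nthEl Λ.2 i + i)

/-- `ᵀΘ(A,B) = Θ(B,A)`. -/
def thetaT (Λ : BPair) : BPair := theta (Λ.2, Λ.1)

/-- `Π^d` for `d ≥ 1`: adjoin `{0,2,…,2d-4}` to the first row and add `2d-2`
to its entries. -/
def piPos (d : ℕ) (P : BPair) : BPair := (evShift (d - 1) P.1, P.2)

/-- `Π^d` for `d = -e ≤ -1`: adjoin `{1,3,…,2e+1}` to the second row and add
`2e+2` to its entries. -/
def piNeg (e : ℕ) (P : BPair) : BPair := (P.1, odShift (e + 1) P.2)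

/-- `Δ_B^t = Π^{2t+1} ∘ Θ'`. -/
def deltaB (t : ℕ) (Λ : BPair) : BPair := piPos (2 * t + 1) (theta' Λ)

/-- `Δ_C^t = Π^{4t+1} ∘ Θ`. -/
def deltaC (t : ℕ) (Λ : BPair) : BPair := piPos (4 * t + 1) (theta Λ)

/-- `Δ_{C'}^t = Π^{1-4t} ∘ ᵀΘ` (for `t ≥ 1`). -/
def deltaC' (t : ℕ) (Λ : BPair) : BPair := piNeg (4 * t - 1) (thetaT Λ)

/-- `Δ_D^t = Π^{4t} ∘ Θ'` (for `t ≥ 1`). -/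
def deltaD (t : ℕ) (Λ : BPair) : BPair := piPos (4 * t) (theta' Λ)

/-- `Δ_D^0 = Θ̄`. -/
def deltaD0 (Λ : BPair) : BPair := thetaBar Λ

/-- All entries of a pair (with multiplicity) in weakly increasing order. -/
def entries (P : BPair) : List ℕ := (P.1.val + P.2.val).sort (· ≤ ·)

/-- `Σ_j (len-1-j) ⬝ (L[j] - ref j)`, the common shape of `a`, `b` and `σ`. -/
def wsum (L : List ℕ) (ref : ℕ → ℕ) : ℤ :=
  ∑ j ∈ Finset.range L.length,
    ((L.length - 1 - j : ℕ) : ℤ) * ((L.getD j 0 : ℤ) - (ref j : ℤ))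

/-- Lusztig's a-function (reference sequence `0,0,1,1,…`). -/
def aFun (P : BPair) : ℤ := wsum (entries P) (fun j => j / 2)

/-- Lusztig's b-function with the 𝕏-reference sequence `0,0,2,2,…`. -/
def bX (P : BPair) : ℤ := wsum (entries P) (fun j => 2 * (j / 2))

/-- Lusztig's b-function with the 𝕐-reference sequence `0,1,2,…`. -/
def bY (P : BPair) : ℤ := wsum (entries P) (fun j => j)

/-- `σ(Λ) = Σ (2k-i)·x_i`. -/
def sigmaFun (P : BPair) : ℤ := wsum (entries P) (fun _ => 0)

/-- Entrywise sum of two rows (of equal size), sorted positions added. -/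
def addRows (X X' : Finset ℕ) : Finset ℕ :=
  (Finset.range X.card).image fun i => nthEl X i + nthEl X' i

/-- `Λ ⊕ Ξ` in the types B and D cases. -/
def oplus (Λ Ξ : BPair) : BPair := (addRows Λ.1 Ξ.1, addRows Λ.2 Ξ.2)

/-- `Λ ⊕ Ξ` in the type C case. -/
def oplusC (Λ Ξ : BPair) : BPair :=
  (insert (nthEl Ξ.1 0)
      ((Finset.range Λ.1.card).image fun i => nthEl Λ.1 i + nthEl Ξ.1 (i + 1) + 1),
   (Finset.range Λ.2.card).image fun j => nthEl Λ.2 j + nthEl Ξ.2 j + 1)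

/-- `Λ ⊞ Ξ`: the twisted combination in type D. -/
def boxplus (Λ Ξ : BPair) : BPair := (addRows Λ.2 Ξ.1, addRows Λ.1 Ξ.2)

/-- Similarity of β-pairs: after shifts, the row unions and row intersections
coincide. -/
def pSimilar (Λ Ξ : BPair) : Prop :=
  ∃ j k, (pShift j Λ).1 ∪ (pShift j Λ).2 = (pShift k Ξ).1 ∪ (pShift k Ξ).2 ∧
    (pShift j Λ).1 ∩ (pShift j Λ).2 = (pShift k Ξ).1 ∩ (pShift k Ξ).2

/-- Similarity in the 𝕏-family: after 𝕏-shifts, the row unions and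
intersections coincide. -/
def xSimilar (P Q : BPair) : Prop :=
  ∃ j k, (xShift j P).1 ∪ (xShift j P).2 = (xShift k Q).1 ∪ (xShift k Q).2 ∧
    (xShift j P).1 ∩ (xShift j P).2 = (xShift k Q).1 ∩ (xShift k Q).2

/-- A β-pair is reduced if it is not a proper shift, i.e. `0` does not lie in
both rows; each shift-equivalence class has a unique reduced representative. -/
def reduced (Λ : BPair) : Prop := ¬ (0 ∈ Λ.1 ∧ 0 ∈ Λ.2)

/-- `a(Λ) + a(Ξ) = b(Λ⊕Ξ)`, computed (as in the paper) on shift-representatives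
with matching row sizes. -/
def minimalPair (Λ Ξ : BPair) : Prop :=
  ∃ Λ' Ξ', pEquiv Λ Λ' ∧ pEquiv Ξ Ξ' ∧ Λ'.1.card = Ξ'.1.card ∧
    Λ'.2.card = Ξ'.2.card ∧ aFun Λ' + aFun Ξ' = bX (oplus Λ' Ξ')

/-- The generating relation `i ≈ i+1` whenever `c_i = c_{i+1}` or `d_i = d_{i+1}`. -/
def linkRel (n : ℕ) (c d : ℕ → ℕ) (i j : Fin n) : Prop :=
  (j : ℕ) = (i : ℕ) + 1 ∧ (c i = c j ∨ d i = d j)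

/-- The equivalence relation generated by `linkRel`. -/
def idxSetoid (n : ℕ) (c d : ℕ → ℕ) : Setoid (Fin n) :=
  ⟨Relation.EqvGen (linkRel n c d), Relation.EqvGen.is_equivalence _⟩

/-- A degenerate equivalence class: `{i, i+1}` with `c_i = c_{i+1}` and
`d_i = d_{i+1}`. -/
def degenClass (n : ℕ) (c d : ℕ → ℕ) (Q : Quotient (idxSetoid n c d)) : Prop :=
  ∃ i j : Fin n, (j : ℕ) = (i : ℕ) + 1 ∧ c i = c j ∧ d i = d j ∧
    Q = Quotient.mk (idxSetoid n c d) i ∧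
    ∀ m : Fin n, Quotient.mk (idxSetoid n c d) m = Q → m = i ∨ m = j

/-- The number `ℓ` of non-degenerate equivalence classes. -/
noncomputable def ellCount (n : ℕ) (c d : ℕ → ℕ) : ℕ :=
  Nat.card {Q : Quotient (idxSetoid n c d) // ¬ degenClass n c d Q}

/-- `Ξ` is obtained from `Λ` by decreasing a single entry by `1`, the result
again being a β-pair. -/
def stepDown (Λ Ξ : BPair) : Prop :=
  (∃ x ∈ Λ.1, 0 < x ∧ x - 1 ∉ Λ.1 ∧ Ξ = (insert (x - 1) (Λ.1.erase x), Λ.2)) ∨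
  (∃ x ∈ Λ.2, 0 < x ∧ x - 1 ∉ Λ.2 ∧ Ξ = (Λ.1, insert (x - 1) (Λ.2.erase x)))

/-- The sum of `min x y` over all ordered pairs of entries of a list. -/
def minSum (L : List ℕ) : ℤ :=
  (L.map fun x => (L.map fun y => ((min x y : ℕ) : ℤ)).sum).sum

theorem minSum_perm {L L' : List ℕ} (h : L.Perm L') : minSum L = minSum L' := by
  unfold minSum
  have hinner : ∀ x : ℕ, (L.map fun y => ((min x y : ℕ) : ℤ)).sum =
      (L'.map fun y => ((min x y : ℕ) : ℤ)).sum := fun x => (h.map _).sum_eq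
  simp only [hinner]
  exact (h.map _).sum_eq

theorem wsum_zero_cons (x : ℕ) (l : List ℕ) :
    wsum (x :: l) (fun _ => 0) = l.length * x + wsum l (fun _ => 0) := by
  unfold wsum
  rw [List.length_cons, Finset.sum_range_succ', add_comm (_ * _)]
  refine congrArg₂ (· + ·) ?_ (by simp)
  refine Finset.sum_congr rfl fun j _ => ?_
  rw [List.getD_cons_succ, show l.length + 1 - 1 - (j + 1) = l.length - 1 - j by omega]

theorem wsum_eq_sub (L : List ℕ) (ref : ℕ → ℕ) :
    wsum L ref = wsum L (fun _ => 0) -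
      ∑ j ∈ Finset.range L.length, ((L.length - 1 - j : ℕ) : ℤ) * (ref j : ℤ) := by
  unfold wsum
  rw [← Finset.sum_sub_distrib]
  refine Finset.sum_congr rfl fun j _ => ?_
  push_cast
  ring

/-- For a sorted list, the weighted sum is determined by the pairwise minima. -/
theorem two_mul_wsum_zero_add_sum {L : List ℕ} (h : L.Pairwise (· ≤ ·)) :
    2 * wsum L (fun _ => 0) + (L.map fun x : ℕ => (x : ℤ)).sum = minSum L := by
  induction L with
  | nil => simp [wsum, minSum]
  | cons x l ih =>
    obtain ⟨hx, hl⟩ := List.pairwise_cons.1 h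
    have hmin : (l.map fun y => ((min x y : ℕ) : ℤ)) = l.map fun _ => (x : ℤ) :=
      List.map_congr_left fun y hy => by rw [min_eq_left (hx y hy)]
    have hmin' : (l.map fun y => ((min y x : ℕ) : ℤ)) = l.map fun _ => (x : ℤ) :=
      List.map_congr_left fun y hy => by rw [min_eq_right (hx y hy)]
    have hsplit : minSum (x :: l) = x + (l.map fun y => ((min x y : ℕ) : ℤ)).sum +
        ((l.map fun y => ((min y x : ℕ) : ℤ)).sum + minSum l) := by
      simp only [minSum, List.map_cons, List.sum_cons, min_self, List.sum_map_add]
    rw [hsplit, hmin, hmin', wsum_zero_cons, ← ih hl]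
    simp only [List.map_cons, List.sum_cons, List.map_const', List.sum_replicate, nsmul_eq_mul]
    ring

theorem nthEl_strictMonoOn {A : Finset ℕ} {i j : ℕ} (hij : i < j) (hj : j < A.card) :
    nthEl A i < nthEl A j := by
  have hj' : j < (A.sort (· ≤ ·)).length := by simpa using hj
  unfold nthEl
  rw [List.getD_eq_getElem _ _ (hij.trans hj'), List.getD_eq_getElem _ _ hj']
  exact List.pairwise_iff_getElem.1 A.sortedLT_sort.pairwise i j _ hj' hij

theorem val_eq_map_nthEl (A : Finset ℕ) :
    A.val = ((List.range A.card).map (nthEl A) : Multiset ℕ) := by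
  rw [← Finset.sort_eq A (· ≤ ·)]
  congr 1
  refine List.ext_getElem (by simp) fun i hi _ => ?_
  rw [List.getElem_map, List.getElem_range, nthEl, List.getD_eq_getElem _ _ hi]

theorem addRows_val {X X' : Finset ℕ} (h : X.card = X'.card) :
    (addRows X X').val =
      ((List.range X.card).map (fun i => nthEl X i + nthEl X' i) : Multiset ℕ) := by
  have hlt : ∀ i j, i < j → j < X.card →
      nthEl X i + nthEl X' i < nthEl X j + nthEl X' j := fun i j hij hj =>
    add_lt_add (nthEl_strictMonoOn hij hj) (nthEl_strictMonoOn hij (h ▸ hj))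
  unfold addRows
  rw [Finset.image_val_of_injOn]
  · rfl
  · intro i hi j hj hij
    simp only [Finset.coe_range, Set.mem_Iio] at hi hj
    rcases lt_trichotomy i j with h' | h' | h'
    · exact absurd hij (hlt i j h' hj).ne
    · exact h'
    · exact absurd hij (hlt j i h' hi).ne'

theorem entries_pairwise (P : BPair) : (entries P).Pairwise (· ≤ ·) :=
  Multiset.pairwise_sort _ _

theorem entries_perm {P : BPair} {p : ℕ} {f g : ℕ → ℕ}
    (hf : P.1.val = ((List.range p).map f : Multiset ℕ))
    (hg : P.2.val = ((List.range p).map g : Multiset ℕ)) :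
    (entries P).Perm ((List.range p).map f ++ (List.range p).map g) := by
  rw [← Multiset.coe_eq_coe, entries, Multiset.sort_eq, hf, hg, Multiset.coe_add]

theorem sum_map_range (p : ℕ) (f : ℕ → ℤ) :
    ((List.range p).map f).sum = ∑ i ∈ Finset.range p, f i := rfl

/-- The function `σ` of a pair whose rows are enumerated by `f` and `g`. -/
theorem two_mul_wsum_entries {P : BPair} {p : ℕ} {f g : ℕ → ℕ}
    (hf : P.1.val = ((List.range p).map f : Multiset ℕ))
    (hg : P.2.val = ((List.range p).map g : Multiset ℕ)) :
    2 * wsum (entries P) (fun _ => 0) =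
      (∑ i ∈ Finset.range p, ∑ j ∈ Finset.range p, ((min (f i) (f j) : ℕ) : ℤ)) +
      (∑ i ∈ Finset.range p, ∑ j ∈ Finset.range p, ((min (g i) (g j) : ℕ) : ℤ)) +
      2 * (∑ i ∈ Finset.range p, ∑ j ∈ Finset.range p, ((min (f i) (g j) : ℕ) : ℤ)) -
      ((∑ i ∈ Finset.range p, (f i : ℤ)) + ∑ i ∈ Finset.range p, (g i : ℤ)) := by
  have hp := entries_perm hf hg
  have h := two_mul_wsum_zero_add_sum (entries_pairwise P)
  rw [minSum_perm hp, (hp.map _).sum_eq] at h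
  simp only [minSum, List.map_append, List.sum_append, List.map_map, Function.comp_def,
    sum_map_range, Finset.sum_add_distrib] at h
  have hswap : ∑ i ∈ Finset.range p, ∑ j ∈ Finset.range p, ((min (g i) (f j) : ℕ) : ℤ) =
      ∑ i ∈ Finset.range p, ∑ j ∈ Finset.range p, ((min (f i) (g j) : ℕ) : ℤ) := by
    rw [Finset.sum_comm]
    simp only [min_comm]
  rw [hswap] at h
  linarith

theorem sum_min_add_of_monotone {p : ℕ} {f g : ℕ → ℕ}
    (hf : ∀ i j, i < j → j < p → f i < f j) (hg : ∀ i j, i < j → j < p → g i < g j) :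
    ∑ i ∈ Finset.range p, ∑ j ∈ Finset.range p, ((min (f i + g i) (f j + g j) : ℕ) : ℤ) =
      (∑ i ∈ Finset.range p, ∑ j ∈ Finset.range p, ((min (f i) (f j) : ℕ) : ℤ)) +
      ∑ i ∈ Finset.range p, ∑ j ∈ Finset.range p, ((min (g i) (g j) : ℕ) : ℤ) := by
  simp only [← Finset.sum_add_distrib]
  refine Finset.sum_congr rfl fun i hi => Finset.sum_congr rfl fun j hj => ?_
  rw [Finset.mem_range] at hi hj
  rcases lt_trichotomy i j with h | rfl | h
  · have := hf i j h hj
    have := hg i j h hj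
    omega
  · omega
  · have := hf j i h hi
    have := hg j i h hi
    omega

/-- Superadditivity of `min`, summed over a square, with its equality case. -/
theorem sum_min_add_eq_iff (p : ℕ) (a b a' b' : ℕ → ℕ) :
    (∑ i ∈ Finset.range p, ∑ j ∈ Finset.range p, ((min (b i) (a j) : ℕ) : ℤ)) +
        (∑ i ∈ Finset.range p, ∑ j ∈ Finset.range p, ((min (a' i) (b' j) : ℕ) : ℤ)) =
      (∑ i ∈ Finset.range p, ∑ j ∈ Finset.range p,
        ((min (b i + a' i) (a j + b' j) : ℕ) : ℤ)) ↔
    ∀ i < p, ∀ j < p, (b i ≤ a j ∧ a' i ≤ b' j) ∨ (a j ≤ b i ∧ b' j ≤ a' i) := by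
  simp only [← Finset.sum_add_distrib]
  rw [Finset.sum_eq_sum_iff_of_le fun i _ => Finset.sum_le_sum fun j _ => by omega]
  simp only [Finset.mem_range]
  refine forall₂_congr fun i _ => ?_
  rw [Finset.sum_eq_sum_iff_of_le fun j _ => by omega]
  simp only [Finset.mem_range]
  exact forall₂_congr fun j _ => by omega

/-- type D, twisted combination: `a(Λ) + a(Ξ) = b(Λ⊞Ξ)` (with
the 𝕏-reference sequence) iff for all `i`, `j` either `b_i ≤ a_j ∧ a_i' ≤ b_j'`
or `b_i ≥ a_j ∧ a_i' ≥ b_j'`. -/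
theorem statement_14 (p : ℕ) (A B A' B' : Finset ℕ)
    (hA : A.card = p) (hB : B.card = p) (hA' : A'.card = p) (hB' : B'.card = p) :
    aFun (A, B) + aFun (A', B') = bX (boxplus (A, B) (A', B')) ↔
      ∀ i < p, ∀ j < p,
        (nthEl B i ≤ nthEl A j ∧ nthEl A' i ≤ nthEl B' j) ∨
        (nthEl A j ≤ nthEl B i ∧ nthEl B' j ≤ nthEl A' i) := by
  have hsum : ∀ X X' : Finset ℕ, X.card = p → X'.card = p →
      (addRows X X').val =
        ((List.range p).map (fun i => nthEl X i + nthEl X' i) : Multiset ℕ) := by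
    rintro X X' rfl h
    exact addRows_val h.symm
  have hrow : ∀ X : Finset ℕ, X.card = p →
      X.val = ((List.range p).map (nthEl X) : Multiset ℕ) := by
    rintro X rfl
    exact val_eq_map_nthEl X
  have hmono : ∀ X : Finset ℕ, X.card = p → ∀ i j, i < j → j < p → nthEl X i < nthEl X j := by
    rintro X rfl i j
    exact nthEl_strictMonoOn
  have h₁ := two_mul_wsum_entries (P := (A, B)) (hrow A hA) (hrow B hB)
  have h₂ := two_mul_wsum_entries (P := (A', B')) (hrow A' hA') (hrow B' hB')
  have h₃ := two_mul_wsum_entries (P := boxplus (A, B) (A', B'))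
    (hsum B A' hB hA') (hsum A B' hA hB')
  rw [sum_min_add_of_monotone (hmono B hB) (hmono A' hA'),
    sum_min_add_of_monotone (hmono A hA) (hmono B' hB')] at h₃
  have hl₁ : (entries (A, B)).length = p + p := by simp [entries, hA, hB]
  have hl₂ : (entries (A', B')).length = p + p := by simp [entries, hA', hB']
  have hl₃ : (entries (boxplus (A, B) (A', B'))).length = p + p := by
    simpa using (entries_perm (P := boxplus (A, B) (A', B'))
      (hsum B A' hB hA') (hsum A B' hA hB')).length_eq
  have href : ∑ j ∈ Finset.range (p + p), ((p + p - 1 - j : ℕ) : ℤ) * ((2 * (j / 2) : ℕ) : ℤ) =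
      2 * ∑ j ∈ Finset.range (p + p), ((p + p - 1 - j : ℕ) : ℤ) * ((j / 2 : ℕ) : ℤ) := by
    rw [Finset.mul_sum]
    refine Finset.sum_congr rfl fun j _ => ?_
    push_cast
    ring
  have hswap : ∑ i ∈ Finset.range p, ∑ j ∈ Finset.range p,
        ((min (nthEl A i) (nthEl B j) : ℕ) : ℤ) =
      ∑ i ∈ Finset.range p, ∑ j ∈ Finset.range p,
        ((min (nthEl B i) (nthEl A j) : ℕ) : ℤ) := by
    rw [Finset.sum_comm]
    simp only [min_comm]
  rw [hswap] at h₁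
  simp only [Nat.cast_add, Finset.sum_add_distrib] at h₃
  rw [← sum_min_add_eq_iff p (nthEl A) (nthEl B) (nthEl A') (nthEl B')]
  unfold aFun bX
  rw [wsum_eq_sub (entries (A, B)), wsum_eq_sub (entries (A', B')),
    wsum_eq_sub (entries (boxplus (A, B) (A', B'))), hl₁, hl₂, hl₃, href]
  constructor <;> intro h <;> linarith

end CSpaper
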